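/- Let n_1, n_2, n_3 be positive integers, let i be the minimum of {n_1, n_2, n_3}, and let j be the minimum of the multiset {n_1, n_2, n_3} after one occurrence of i is removed (the second-smallest value). Then φ(1^{n_1}0^{n_1}1^{n_2}0^{n_2}1^{n_3}0^{n_3}) = (1/2)i² + i·j + (3/2)i + j + 1. -/

import Mathlib

/-- A pairing of the positions `Fin N`: a collection of blocks, each of size 2,
with every position in exactly one block. -/
def IsPairing {N : ℕ} (π : Finset (Finset (Fin N))) : Prop :=
  (∀ B ∈ π, B.card = 2) ∧ ∀ i : Fin N, ∃! B, B ∈ π ∧ i ∈ B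

/-- A crossing: blocks `{i₁,i₂}` and `{j₁,j₂}` with `i₁ < j₁ < i₂ < j₂`. -/
def HasCrossing {N : ℕ} (π : Finset (Finset (Fin N))) : Prop :=
  ∃ B ∈ π, ∃ C ∈ π, ∃ i₁ i₂ j₁ j₂ : Fin N,
    i₁ ∈ B ∧ i₂ ∈ B ∧ j₁ ∈ C ∧ j₂ ∈ C ∧ i₁ < j₁ ∧ j₁ < i₂ ∧ i₂ < j₂

/-- A non-crossing `w`-pairing: a non-crossing pairing of the positions of the
bitstring `w` (ones are `true`, zeros are `false`) pairing unequal letters. -/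
def IsNCPairingOn (w : List Bool) (π : Finset (Finset (Fin w.length))) : Prop :=
  IsPairing π ∧ ¬ HasCrossing π ∧
    ∀ B ∈ π, ∀ i ∈ B, ∀ j ∈ B, i ≠ j → w.get i ≠ w.get j

/-- `phi w` is the number of non-crossing `w`-pairings. -/
noncomputable def phi (w : List Bool) : ℕ :=
  Set.ncard {π : Finset (Finset (Fin w.length)) | IsNCPairingOn w π}

/-- The word `1^{n 0} 0^{m 0} 1^{n 1} 0^{m 1} ⋯ 1^{n (r-1)} 0^{m (r-1)}`. -/
def runsF {r : ℕ} (n m : Fin r → ℕ) : List Bool :=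
  (List.finRange r).flatMap fun i => List.replicate (n i) true ++ List.replicate (m i) false

/-- The word `1^{k₁} 0^{k₁} ⋯ 1^{k_r} 0^{k_r}` for `l = [k₁, …, k_r]`. -/
def symWord (l : List ℕ) : List Bool :=
  l.flatMap fun k => List.replicate k true ++ List.replicate k false

/-- The symmetrized pairing function `φ*(n₁,…,n_r) = φ(1^{n₁}0^{n₁}⋯1^{n_r}0^{n_r})`. -/
noncomputable def phiStar (l : List ℕ) : ℕ := phi (symWord l)

/-- `Yval w i` is the lattice-path value `Y_i`. -/
def Yval (w : List Bool) (i : ℕ) : ℤ :=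
  ((w.take i).count true : ℤ) - ((w.take i).count false : ℤ)

/-- The height of position `i` of `w`, relative to the minimum `mY` of the `Y_i`. -/
def heightAt (w : List Bool) (mY : ℤ) (i : Fin w.length) : ℤ :=
  if w.get i then Yval w (i.val + 1) - mY else Yval w (i.val + 1) - mY + 1

/-- `d : Fin r → ℕ` is a Catalan degree sequence of order `r`. -/
def IsCatalanSeq (r : ℕ) (d : Fin r → ℕ) : Prop :=
  (∀ i : ℕ, 1 ≤ i → i ≤ r - 1 →
      (i : ℕ) ≤ ∑ j ∈ Finset.univ.filter (fun j : Fin r => (j : ℕ) < i), d j) ∧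
  ∑ j, d j = r - 1

/-- Sum of the first `j` values of `f`. -/
def prefSum {r : ℕ} (f : Fin r → ℕ) (j : ℕ) : ℕ :=
  ∑ i ∈ Finset.univ.filter (fun i : Fin r => (i : ℕ) < j), f i

/-- `m` is a member of `CF(n)`. -/
def InCF {r : ℕ} (n m : Fin r → ℕ) : Prop :=
  (∀ j : ℕ, 1 ≤ j → j ≤ r - 1 → prefSum m j ≤ prefSum n j) ∧
  (∑ i, m i = ∑ i, n i)


/-- `stackCount s w` counts the ways to read `w` starting from the stack `s` and ending with the
empty stack, where each letter is either pushed or cancelled against a different letter on top. -/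
def stackCount : List Bool → List Bool → ℕ
  | [], [] => 1
  | _ :: _, [] => 0
  | [], a :: w => stackCount [a] w
  | b :: s, a :: w => stackCount (a :: b :: s) w + if b = a then 0 else stackCount s w

/-- `π` is a non-crossing pairing of the elements of the lists `S` and `W` matching elements of
different colours, in which no block lies inside `S`. -/
structure IsStackPairing {α : Type*} [LinearOrder α] (c : α → Bool) (S W : List α)
    (π : Finset (Finset α)) : Prop where
  card_eq : ∀ B ∈ π, B.card = 2
  mem_or : ∀ B ∈ π, ∀ i ∈ B, i ∈ S ∨ i ∈ W
  cover : ∀ i, i ∈ S ∨ i ∈ W → ∃ B ∈ π, i ∈ B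
  eq_of_mem : ∀ i, ∀ B ∈ π, ∀ C ∈ π, i ∈ B → i ∈ C → B = C
  noncrossing : ∀ B ∈ π, ∀ C ∈ π, ∀ i₁ ∈ B, ∀ i₂ ∈ B, ∀ j₁ ∈ C, ∀ j₂ ∈ C,
    i₁ < j₁ → j₁ < i₂ → i₂ < j₂ → False
  colour_ne : ∀ B ∈ π, ∀ i ∈ B, ∀ j ∈ B, i ≠ j → c i ≠ c j
  exists_mem : ∀ B ∈ π, ∃ i ∈ B, i ∈ W

namespace IsStackPairing

variable {α : Type*} [LinearOrder α] {c : α → Bool} {S W : List α} {a y : α}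
  {π : Finset (Finset α)}

theorem of_push (h : IsStackPairing c (a :: S) W π) : IsStackPairing c S (a :: W) π where
  card_eq := h.card_eq
  mem_or B hB i hi := by have := h.mem_or B hB i hi; simp at this ⊢; tauto
  cover i hi := h.cover i (by simp at hi ⊢; tauto)
  eq_of_mem := h.eq_of_mem
  noncrossing := h.noncrossing
  colour_ne := h.colour_ne
  exists_mem B hB := by
    obtain ⟨i, hi, hW⟩ := h.exists_mem B hB
    exact ⟨i, hi, List.mem_cons_of_mem _ hW⟩

theorem push (h : IsStackPairing c S (a :: W) π) (hB : ∀ B ∈ π, ∃ i ∈ B, i ∈ W) :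
    IsStackPairing c (a :: S) W π where
  card_eq := h.card_eq
  mem_or B hB i hi := by have := h.mem_or B hB i hi; simp at this ⊢; tauto
  cover i hi := h.cover i (by simp at hi ⊢; tauto)
  eq_of_mem := h.eq_of_mem
  noncrossing := h.noncrossing
  colour_ne := h.colour_ne
  exists_mem := hB

/-- Inserting a block formed by the top of the stack and the next element. -/
theorem insert_block (hS : (y :: S).Pairwise (· > ·)) (hW : (a :: W).Pairwise (· < ·))
    (hSW : ∀ x ∈ y :: S, ∀ z ∈ a :: W, x < z) (hc : c y ≠ c a) (h : IsStackPairing c S W π) :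
    IsStackPairing c (y :: S) (a :: W) (insert {y, a} π) := by
  simp only [List.pairwise_cons] at hS hW
  have hya : y < a := hSW y (by simp) a (by simp)
  have hgap : ∀ B ∈ π, ∀ i ∈ B, i < y ∨ a < i := fun B hB i hi => by
    rcases h.mem_or B hB i hi with hi | hi
    · exact Or.inl (hS.1 i hi)
    · exact Or.inr (hW.1 i hi)
  refine ⟨?_, ?_, ?_, ?_, ?_, ?_, ?_⟩
  · simp only [Finset.forall_mem_insert]
    exact ⟨Finset.card_pair hya.ne, h.card_eq⟩
  · simp only [Finset.forall_mem_insert]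
    refine ⟨by simp, fun B hB i hi => ?_⟩
    rcases h.mem_or B hB i hi with hi | hi <;> simp [hi]
  · intro i hi
    by_cases hi' : i = y ∨ i = a
    · exact ⟨{y, a}, by simp, by simpa using hi'⟩
    · obtain ⟨B, hB, hiB⟩ := h.cover i (by simp at hi; tauto)
      exact ⟨B, by simp [hB], hiB⟩
  · intro i B hB C hC hiB hiC
    rw [Finset.mem_insert] at hB hC
    rcases hB with rfl | hB <;> rcases hC with rfl | hC
    · rfl
    · have := hgap C hC i hiC
      simp at hiB
      rcases hiB with rfl | rfl
      · rcases this with h | h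
        · exact absurd h (lt_irrefl _)
        · exact absurd h hya.not_gt
      · rcases this with h | h
        · exact absurd h hya.not_gt
        · exact absurd h (lt_irrefl _)
    · have := hgap B hB i hiB
      simp at hiC
      rcases hiC with rfl | rfl
      · rcases this with h | h
        · exact absurd h (lt_irrefl _)
        · exact absurd h hya.not_gt
      · rcases this with h | h
        · exact absurd h hya.not_gt
        · exact absurd h (lt_irrefl _)
    · exact h.eq_of_mem i B hB C hC hiB hiC
  · intro B hB C hC i₁ hi₁ i₂ hi₂ j₁ hj₁ j₂ hj₂ h₁ h₂ h₃
    rw [Finset.mem_insert] at hB hC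
    rcases hB with rfl | hB <;> rcases hC with rfl | hC
    · simp at hi₁ hi₂ hj₁ hj₂; grind
    · have := hgap C hC j₁ hj₁
      simp at hi₁ hi₂; grind
    · have := hgap B hB i₂ hi₂
      simp at hj₁ hj₂; grind
    · exact h.noncrossing B hB C hC i₁ hi₁ i₂ hi₂ j₁ hj₁ j₂ hj₂ h₁ h₂ h₃
  · rw [Finset.forall_mem_insert]
    refine ⟨?_, h.colour_ne⟩
    intro i hi j hj hij
    simp at hi hj
    rcases hi with rfl | rfl <;> rcases hj with rfl | rfl
    · exact absurd rfl hij
    · exact hc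
    · exact hc.symm
    · exact absurd rfl hij
  · simp only [Finset.forall_mem_insert]
    refine ⟨⟨a, by simp, by simp⟩, fun B hB => ?_⟩
    obtain ⟨i, hi, hW⟩ := h.exists_mem B hB
    exact ⟨i, hi, List.mem_cons_of_mem _ hW⟩

/-- Erasing a block formed by the top of the stack and the next element. -/
theorem erase_block (hS : (y :: S).Pairwise (· > ·)) (hW : (a :: W).Pairwise (· < ·))
    (hSW : ∀ x ∈ y :: S, ∀ z ∈ a :: W, x < z) (h : IsStackPairing c (y :: S) (a :: W) π) (hB : {y, a} ∈ π) :
    IsStackPairing c S W (π.erase {y, a}) := by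
  simp only [List.pairwise_cons] at hS hW
  have hne : ∀ C ∈ π, C ≠ {y, a} → ∀ i ∈ C, i ≠ y ∧ i ≠ a := by
    refine fun C hC hCB i hi => ⟨?_, ?_⟩
    · rintro rfl
      exact hCB (h.eq_of_mem i C hC _ hB hi (by simp))
    · rintro rfl
      exact hCB (h.eq_of_mem i C hC _ hB hi (by simp))
  refine ⟨fun C hC => h.card_eq C (Finset.mem_of_mem_erase hC), ?_, ?_, ?_, ?_, ?_, ?_⟩
  · intro C hC i hi
    rw [Finset.mem_erase] at hC
    have h1 := h.mem_or C hC.2 i hi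
    have h2 := hne C hC.2 hC.1 i hi
    simp at h1; tauto
  · intro i hi
    obtain ⟨C, hC, hiC⟩ := h.cover i (by simp; tauto)
    refine ⟨C, Finset.mem_erase.2 ⟨?_, hC⟩, hiC⟩
    rintro rfl
    simp only [Finset.mem_insert, Finset.mem_singleton] at hiC
    rcases hiC with rfl | rfl <;> rcases hi with hi | hi
    · exact lt_irrefl _ (hS.1 i hi)
    · exact lt_irrefl _ (hSW i (by simp) i (by simp [hi]))
    · exact lt_irrefl _ (hSW i (by simp [hi]) i (by simp))
    · exact lt_irrefl _ (hW.1 i hi)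
  · exact fun i C hC D hD => h.eq_of_mem i C (Finset.mem_of_mem_erase hC) D
      (Finset.mem_of_mem_erase hD)
  · exact fun C hC D hD => h.noncrossing C (Finset.mem_of_mem_erase hC) D
      (Finset.mem_of_mem_erase hD)
  · exact fun C hC => h.colour_ne C (Finset.mem_of_mem_erase hC)
  · intro C hC
    rw [Finset.mem_erase] at hC
    obtain ⟨i, hi, hiW⟩ := h.exists_mem C hC.2
    have h2 := hne C hC.2 hC.1 i hi
    simp only [List.mem_cons] at hiW
    exact ⟨i, hi, by tauto⟩

/-- A block with no element after `a` joins `a` to the top of the stack. -/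
theorem exists_top (hS : S.Pairwise (· > ·))
    (hSW : ∀ x ∈ S, ∀ z ∈ a :: W, x < z) (hW : (a :: W).Pairwise (· < ·))
    (h : IsStackPairing c S (a :: W) π) {B : Finset α} (hB : B ∈ π) (hBW : ∀ i ∈ B, i ∉ W) :
    ∃ y T, S = y :: T ∧ B = {y, a} := by
  obtain ⟨i, hi, hia⟩ := h.exists_mem B hB
  have haB : a ∈ B := by
    rcases List.mem_cons.1 hia with rfl | hia
    · exact hi
    · exact absurd hia (hBW i hi)
  obtain ⟨x, hxa, hBx⟩ : ∃ x, x ≠ a ∧ B = {x, a} := by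
    obtain ⟨u, v, huv, rfl⟩ := Finset.card_eq_two.1 (h.card_eq B hB)
    simp at haB
    rcases haB with rfl | rfl
    · exact ⟨v, huv.symm, Finset.pair_comm _ _⟩
    · exact ⟨u, huv, rfl⟩
  have hxS : x ∈ S := by
    have h1 := h.mem_or B hB x (by simp [hBx])
    have h2 := hBW x (by simp [hBx])
    simp at h1; tauto
  cases S with
  | nil => simp at hxS
  | cons y T =>
    refine ⟨y, T, rfl, ?_⟩
    rcases List.mem_cons.1 hxS with rfl | hxT
    · exact hBx
    exfalso
    have hxy : x < y := (List.pairwise_cons.1 hS).1 x hxT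
    have hya : y < a := hSW y (by simp) a (by simp)
    obtain ⟨C, hC, hyC⟩ := h.cover y (by simp)
    have hyB : y ∉ B := by simp [hBx, hxy.ne', hya.ne]
    obtain ⟨z, hz, hzW⟩ := h.exists_mem C hC
    have hza : z ≠ a := by
      rintro rfl
      exact hyB (h.eq_of_mem z B hB C hC haB hz ▸ hyC)
    have haz : a < z := (List.pairwise_cons.1 hW).1 z (by simp at hzW; tauto)
    exact h.noncrossing B hB C hC x (by simp [hBx]) a haB y hyC z hz hxy hya haz

end IsStackPairing

theorem setOf_isStackPairing_cons {α : Type*} [LinearOrder α] {c : α → Bool} {S W : List α}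
    {a y : α} (hS : (y :: S).Pairwise (· > ·)) (hW : (a :: W).Pairwise (· < ·))
    (hSW : ∀ x ∈ y :: S, ∀ z ∈ a :: W, x < z) (hc : c y ≠ c a) :
    {π | IsStackPairing c (y :: S) (a :: W) π} =
      {π | IsStackPairing c (a :: y :: S) W π} ∪ insert {y, a} '' {π | IsStackPairing c S W π} := by
  ext π
  simp only [Set.mem_union, Set.mem_image, Set.mem_ofPred_eq]
  constructor
  · intro h
    by_cases hB : ∀ B ∈ π, ∃ i ∈ B, i ∈ W
    · exact Or.inl (h.push hB)
    · push Not at hB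
      obtain ⟨B, hB, hBW⟩ := hB
      obtain ⟨y', T, hyT, rfl⟩ := h.exists_top hS hSW hW hB hBW
      obtain ⟨rfl, rfl⟩ := List.cons.inj hyT
      exact Or.inr ⟨_, h.erase_block hS hW hSW hB, Finset.insert_erase hB⟩
  · rintro (h | ⟨π, h, rfl⟩)
    · exact h.of_push
    · exact h.insert_block hS hW hSW hc

theorem setOf_isStackPairing_push {α : Type*} [LinearOrder α] {c : α → Bool} {S W : List α}
    {a : α} (hS : S.Pairwise (· > ·)) (hW : (a :: W).Pairwise (· < ·))
    (hSW : ∀ x ∈ S, ∀ z ∈ a :: W, x < z) (hc : ∀ y ∈ S.head?, c y = c a) :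
    {π | IsStackPairing c S (a :: W) π} = {π | IsStackPairing c (a :: S) W π} := by
  ext π
  refine ⟨fun h => h.push ?_, fun h => h.of_push⟩
  by_contra hB
  push Not at hB
  obtain ⟨B, hB, hBW⟩ := hB
  obtain ⟨y, T, rfl, rfl⟩ := h.exists_top hS hSW hW hB hBW
  exact h.colour_ne _ hB y (by simp) a (by simp) (hSW y (by simp) a (by simp)).ne (hc y (by simp))

theorem ncard_isStackPairing {α : Type*} [LinearOrder α] [Fintype α] (c : α → Bool)
    (W : List α) : ∀ S : List α, S.Pairwise (· > ·) → W.Pairwise (· < ·) →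
      (∀ x ∈ S, ∀ z ∈ W, x < z) →
      {π | IsStackPairing c S W π}.ncard = stackCount (S.map c) (W.map c) := by
  induction W with
  | nil =>
    intro S _ _ _
    cases S with
    | nil =>
      have : {π | IsStackPairing c [] [] π} = {∅} := by
        ext π
        simp only [Set.mem_ofPred_eq, Set.mem_singleton_iff]
        constructor
        · intro h
          refine Finset.eq_empty_of_forall_notMem fun B hB => ?_
          simpa using h.exists_mem B hB
        · rintro rfl
          constructor <;> simp
      simp [this, stackCount]
    | cons y S =>
      have : {π | IsStackPairing c (y :: S) [] π} = ∅ := by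
        refine Set.eq_empty_of_forall_notMem fun π h => ?_
        obtain ⟨B, hB, -⟩ := h.cover y (by simp)
        simpa using h.exists_mem B hB
      simp [this, stackCount]
  | cons a W ih =>
    intro S hS hW hSW
    have hW' := List.pairwise_cons.1 hW
    have key := ih (a :: S) (List.pairwise_cons.2 ⟨fun x hx => hSW x hx a (by simp), hS⟩) hW'.2 (by
      intro x hx z hz
      rcases List.mem_cons.1 hx with rfl | hx
      · exact hW'.1 z hz
      · exact hSW x hx z (by simp [hz]))
    cases S with
    | nil =>
      rw [setOf_isStackPairing_push hS hW hSW (by simp), key]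
      simp [stackCount]
    | cons y S =>
      by_cases hc : c y = c a
      · rw [setOf_isStackPairing_push hS hW hSW (by simpa using hc), key]
        simp [stackCount, hc]
      · have hnot : ∀ π, IsStackPairing c S W π → {y, a} ∉ π := fun π h hB => by
          rcases h.mem_or _ hB y (by simp) with hy | hy
          · exact lt_irrefl _ ((List.pairwise_cons.1 hS).1 y hy)
          · exact lt_irrefl _ (hSW y (by simp) y (by simp [hy]))
        rw [setOf_isStackPairing_cons hS hW hSW hc, Set.ncard_union_eq, key,
          Set.InjOn.ncard_image, ih S (List.pairwise_cons.1 hS).2 hW'.2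
            fun x hx z hz => hSW x (by simp [hx]) z (by simp [hz])]
        · simp [stackCount, hc]
        · intro π h π' h' heq
          rw [← Finset.erase_insert (hnot π h), ← Finset.erase_insert (hnot π' h')]
          exact congrArg (Finset.erase · {y, a}) heq
        · rw [Set.disjoint_left]
          rintro _ h ⟨π, h', rfl⟩
          obtain ⟨i, hi, hiW⟩ := IsStackPairing.exists_mem h {y, a} (by simp)
          simp at hi
          rcases hi with rfl | rfl
          · exact lt_irrefl _ (hSW i (by simp) i (by simp [hiW]))
          · exact lt_irrefl _ (hW'.1 i hiW)

theorem phi_eq_stackCount (w : List Bool) : phi w = stackCount [] w := by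
  have hset : {π | IsNCPairingOn w π} =
      {π | IsStackPairing w.get [] (List.finRange w.length) π} := by
    ext π
    simp only [Set.mem_ofPred_eq]
    constructor
    · rintro ⟨⟨h1, h2⟩, h3, h4⟩
      refine ⟨h1, by simp, fun i _ => ?_, fun i B hB C hC hiB hiC => ?_, ?_, h4, fun B hB => ?_⟩
      · obtain ⟨B, hB, -⟩ := h2 i
        exact ⟨B, hB⟩
      · exact (h2 i).unique ⟨hB, hiB⟩ ⟨hC, hiC⟩
      · intro B hB C hC i₁ hi₁ i₂ hi₂ j₁ hj₁ j₂ hj₂ h₁ h₂ h₃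
        exact h3 ⟨B, hB, C, hC, i₁, i₂, j₁, j₂, hi₁, hi₂, hj₁, hj₂, h₁, h₂, h₃⟩
      · obtain ⟨i, hi⟩ := Finset.card_pos.1 (by rw [h1 B hB]; norm_num)
        exact ⟨i, hi, List.mem_finRange i⟩
    · intro h
      refine ⟨⟨h.card_eq, fun i => ?_⟩, ?_, h.colour_ne⟩
      · obtain ⟨B, hB, hi⟩ := h.cover i (by simp)
        exact ⟨B, ⟨hB, hi⟩, fun C hC => h.eq_of_mem i C hC.1 B hB hC.2 hi⟩
      · rintro ⟨B, hB, C, hC, i₁, i₂, j₁, j₂, hi₁, hi₂, hj₁, hj₂, h₁, h₂, h₃⟩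
        exact h.noncrossing B hB C hC i₁ hi₁ i₂ hi₂ j₁ hj₁ j₂ hj₂ h₁ h₂ h₃
  rw [phi, hset, ncard_isStackPairing _ _ _ (by simp) (List.pairwise_lt_finRange _) (by simp)]
  simp

theorem List.replicate_append_cons_self {α : Type*} (n : ℕ) (a : α) (s : List α) :
    List.replicate n a ++ a :: s = a :: (List.replicate n a ++ s) := by
  rw [← List.cons_append, ← List.replicate_succ, List.replicate_succ', List.append_assoc,
    List.singleton_append]

theorem stackCount_push_replicate (a : Bool) (s w : List Bool) (hs : ∀ b ∈ s.head?, b = a)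
    (n : ℕ) : stackCount s (List.replicate n a ++ w) = stackCount (List.replicate n a ++ s) w := by
  induction n generalizing s with
  | zero => simp
  | succ n ih =>
    have hstep : stackCount s (a :: (List.replicate n a ++ w)) =
        stackCount (a :: s) (List.replicate n a ++ w) := by
      cases s with
      | nil => simp [stackCount]
      | cons b s => simp at hs; simp [stackCount, hs]
    rw [List.replicate_succ, List.cons_append, hstep, ih _ (by simp),
      List.replicate_append_cons_self, List.cons_append]

/-- Reading a run of `n` letters on top of a maximal run of `m` opposite letters: cancel the first
`p` of them, then push the others. -/
theorem stackCount_replicate_append (a : Bool) (s w : List Bool) (hs : ∀ b ∈ s.head?, b = a)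
    (m n : ℕ) :
    stackCount (List.replicate m (!a) ++ s) (List.replicate n a ++ w) =
      ∑ p ∈ Finset.range (min m n + 1),
        stackCount (List.replicate (n - p) a ++ (List.replicate (m - p) (!a) ++ s)) w := by
  induction m generalizing n with
  | zero => simp [stackCount_push_replicate a s w hs]
  | succ m ih =>
    cases n with
    | zero => simp
    | succ n =>
      rw [Nat.succ_min_succ, Finset.sum_range_succ']
      simp only [Nat.add_sub_add_right, Nat.sub_zero]
      rw [← ih n]
      simp only [List.replicate_succ, List.cons_append, stackCount]
      rw [stackCount_push_replicate a _ w (by simp)]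
      simp [List.replicate_append_cons_self, add_comm]

theorem stackCount_replicate (a : Bool) (n : ℕ) (s : List Bool) :
    stackCount s (List.replicate n a) = if s = List.replicate n (!a) then 1 else 0 := by
  induction n generalizing s with
  | zero => cases s <;> simp [stackCount]
  | succ n ih =>
    cases s with
    | nil =>
      rw [List.replicate_succ, stackCount, ih]
      cases n <;> simp [List.replicate_succ]
    | cons b s =>
      have : ¬ (a :: b :: s = List.replicate n (!a)) := by
        cases n <;> simp [List.replicate_succ]
      simp only [List.replicate_succ, stackCount, ih, this, List.cons.injEq]
      cases a <;> cases b <;> simp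

open Classical in
/-- The stacks that can be emptied by reading `1^m 0^(m+d)` are `0^e 1^(d+e)` with `e ≤ m`. -/
theorem stackCount_two_runs (m d : ℕ) (s : List Bool) :
    stackCount s (List.replicate m true ++ List.replicate (m + d) false) =
      if ∃ e ≤ m, s = List.replicate e false ++ List.replicate (d + e) true then 1 else 0 := by
  induction m generalizing s d with
  | zero => simp [stackCount_replicate]
  | succ m ih =>
    have htrue : ∀ t, (∃ e ≤ m, true :: t =
        List.replicate e false ++ List.replicate (d + 1 + e) true) ↔
        t = List.replicate d true := by
      intro t
      constructor
      · rintro ⟨e, he, h⟩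
        cases e with
        | zero => simpa [List.replicate_succ] using h
        | succ e => simp [List.replicate_succ] at h
      · rintro rfl
        exact ⟨0, by simp, by simp [List.replicate_succ]⟩
    have hsplit : (∃ e ≤ m + 1, s = List.replicate e false ++ List.replicate (d + e) true) ↔
        s = List.replicate d true ∨ ∃ e ≤ m, s = false ::
          (List.replicate e false ++ List.replicate (d + 1 + e) true) := by
      constructor
      · rintro ⟨e, he, rfl⟩
        cases e with
        | zero => simp
        | succ e =>
          refine Or.inr ⟨e, by omega, ?_⟩
          rw [List.replicate_succ, List.cons_append, add_right_comm d 1 e, add_assoc]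
      · rintro (rfl | ⟨e, he, rfl⟩)
        · exact ⟨0, by simp, by simp⟩
        · refine ⟨e + 1, by omega, ?_⟩
          rw [List.replicate_succ, List.cons_append, add_right_comm d 1 e, add_assoc]
    have e1 : m + 1 + d = m + (d + 1) := by ring
    simp only [hsplit]
    rw [e1, List.replicate_succ, List.cons_append]
    match s with
    | [] => simp [stackCount, ih, htrue]
    | true :: s => simp [stackCount, ih, htrue]
    | false :: s =>
      have : false :: s ≠ List.replicate d true := by cases d <;> simp [List.replicate_succ]
      simp [stackCount, ih, htrue, this]

theorem stackCount_two_equal_runs (m e : ℕ) (f : ℕ) :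
    stackCount (List.replicate e false ++ List.replicate f true)
      (List.replicate m true ++ List.replicate m false) = if e = f ∧ e ≤ m then 1 else 0 := by
  have h := stackCount_two_runs m 0 (List.replicate e false ++ List.replicate f true)
  rw [add_zero] at h
  rw [h]
  congr 1
  rw [eq_iff_iff]
  constructor
  · rintro ⟨e', he', h⟩
    have h1 := congrArg (List.count true) h
    have h2 := congrArg (List.count false) h
    simp [List.count_replicate] at h1 h2
    omega
  · rintro ⟨rfl, he⟩
    exact ⟨e, he, by simp⟩

theorem stackCount_two_equal_runs_eq_zero (m e x b : ℕ) (s : List Bool) (hx : 0 < x)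
    (hb : 0 < b) :
    stackCount (List.replicate e false ++
      (List.replicate x true ++ (List.replicate b false ++ s)))
      (List.replicate m true ++ List.replicate m false) = 0 := by
  have h := stackCount_two_runs m 0 (List.replicate e false ++
      (List.replicate x true ++ (List.replicate b false ++ s)))
  rw [add_zero] at h
  rw [h, if_neg]
  rintro ⟨e', -, h⟩
  have hsorted : (List.replicate e' false ++ List.replicate (0 + e') true).Pairwise (· ≤ ·) := by
    simp [List.pairwise_append, List.pairwise_replicate]
  rw [← h] at hsorted
  have := (List.pairwise_append.1 (List.pairwise_append.1 hsorted).2.1).2.2 true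
    (by simp; omega) false (by simp; omega)
  exact absurd this (by decide)

/-- Reading `1^n 0^n 1^m 0^m` from the stack `0^a 1^a`. -/
theorem stackCount_four_runs (a n m : ℕ) :
    stackCount (List.replicate a false ++ List.replicate a true)
      (List.replicate n true ++ (List.replicate n false ++
        (List.replicate m true ++ List.replicate m false))) =
      (if a ≤ n then min n m + 1 else 0) + if a ≤ m then min a (n + 1) else 0 := by
  have hrun := stackCount_replicate_append true (List.replicate a true)
    (List.replicate n false ++ (List.replicate m true ++ List.replicate m false))
    (by cases a <;> simp [List.replicate_succ]) a n
  have hterm : ∀ q ∈ Finset.range (min a n + 1),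
      stackCount (List.replicate (n - q) true ++ (List.replicate (a - q) (!true) ++
        List.replicate a true))
        (List.replicate n false ++ (List.replicate m true ++ List.replicate m false)) =
      (if q = a then min n m + 1 else 0) + if q < a ∧ a ≤ m then 1 else 0 := by
    intro q hq
    have hq' : q ≤ a ∧ q ≤ n := by simp at hq; omega
    by_cases hqa : q = a
    · subst hqa
      have h := stackCount_replicate_append false []
        (List.replicate m true ++ List.replicate m false) (by simp) n n
      simp only [Bool.not_false, List.append_nil, min_self, stackCount_two_equal_runs,
        true_and] at h
      rw [Nat.sub_self, List.replicate_zero, List.nil_append, ← List.replicate_add,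
        Nat.sub_add_cancel hq'.2, h, ← Finset.sum_range_reflect, Finset.sum_congr rfl (g := fun e => if e ≤ m then 1 else 0),
        ← Finset.card_filter]
      · have : {e ∈ Finset.range (n + 1) | e ≤ m} = Finset.range (min n m + 1) := by
          ext e; simp
        simp [this]
      · intro e he
        simp at he
        have : n - (n + 1 - 1 - e) = e := by omega
        rw [this]
    · have h := stackCount_replicate_append false
        (List.replicate (a - q) false ++ List.replicate a true)
        (List.replicate m true ++ List.replicate m false) (by
          obtain ⟨b, hb⟩ : ∃ b, a - q = b + 1 := ⟨a - q - 1, by omega⟩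
          simp [hb, List.replicate_succ]) (n - q) n
      simp only [Bool.not_false, Bool.not_true] at h ⊢
      rw [h, Finset.sum_eq_single (n - q)]
      · rw [Nat.sub_self, List.replicate_zero, List.nil_append, ← List.append_assoc,
          ← List.replicate_add, stackCount_two_equal_runs]
        have : n - (n - q) + (a - q) = a := by omega
        have hlt : q < a := by omega
        simp [this, hqa, hlt]
      · intro p hp hpq
        simp at hp
        exact stackCount_two_equal_runs_eq_zero _ _ _ _ _ (by omega) (by omega)
      · intro h
        simp at h
  rw [Bool.not_true] at hrun hterm
  rw [hrun, Finset.sum_congr rfl hterm, Finset.sum_add_distrib]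
  congr 1
  · rw [Finset.sum_ite_eq']
    simp
  · rw [← Finset.card_filter]
    split_ifs with ham
    · have : {q ∈ Finset.range (min a n + 1) | q < a ∧ a ≤ m} = Finset.range (min a (n + 1)) := by
        ext q; simp; omega
      rw [this, Finset.card_range]
    · simp [ham]

theorem two_mul_sum_min (N M : ℕ) :
    2 * ∑ a ∈ Finset.range (N + 1), min a (M + 1) =
      min N M * (min N M + 1) + 2 * (N - M) * (M + 1) := by
  induction N with
  | zero => simp
  | succ N ih =>
    rw [Finset.sum_range_succ, mul_add, ih]
    rcases le_or_gt M N with h | h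
    · obtain ⟨t, rfl⟩ := Nat.exists_eq_add_of_le h
      have h1 : M + t + 1 - M = t + 1 := by omega
      have h2 : min (M + t + 1) M = M ∧ min (M + t + 1) (M + 1) = M + 1 ∧ min (M + t) M = M := by
        omega
      rw [h1, h2.1, h2.2.1, h2.2.2, Nat.add_sub_cancel_left]
      ring
    · have h1 : min (N + 1) M = N + 1 ∧ min (N + 1) (M + 1) = N + 1 ∧ min N M = N := by omega
      rw [h1.1, h1.2.1, h1.2.2, Nat.sub_eq_zero_of_le h.le, Nat.sub_eq_zero_of_le h]
      ring

theorem phiStar_three (n1 n2 n3 : ℕ) :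
    phiStar [n1, n2, n3] = (min n1 n2 + 1) * (min n2 n3 + 1) +
      ∑ a ∈ Finset.range (min n1 n3 + 1), min a (n2 + 1) := by
  have hword : symWord [n1, n2, n3] = List.replicate n1 true ++ (List.replicate n1 false ++
      (List.replicate n2 true ++ (List.replicate n2 false ++
        (List.replicate n3 true ++ List.replicate n3 false)))) := by
    simp [symWord]
  rw [phiStar, phi_eq_stackCount, hword, stackCount_push_replicate true _ _ (by simp)]
  have h := stackCount_replicate_append false [] (List.replicate n2 true ++
    (List.replicate n2 false ++ (List.replicate n3 true ++ List.replicate n3 false)))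
    (by simp) n1 n1
  simp only [Bool.not_false, List.append_nil, min_self] at h
  rw [List.append_nil, h, ← Finset.sum_range_reflect]
  rw [Finset.sum_congr rfl (g := fun a => (if a ≤ n2 then min n2 n3 + 1 else 0) +
    if a ≤ n3 then min a (n2 + 1) else 0), Finset.sum_add_distrib, ← Finset.sum_filter,
    ← Finset.sum_filter]
  · have hf : ∀ b, {a ∈ Finset.range (n1 + 1) | a ≤ b} = Finset.range (min n1 b + 1) := by
      intro b; ext a; simp
    rw [hf, hf, Finset.sum_const, Finset.card_range, smul_eq_mul]
  · intro a ha
    simp at ha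
    have : n1 - (n1 + 1 - 1 - a) = a := by omega
    rw [this, stackCount_four_runs]

/-- If `i ≤ j ≤ k` is the sorted rearrangement of the multiset
`{n₁, n₂, n₃}` of positive integers, then
`φ(1^{n₁}0^{n₁}1^{n₂}0^{n₂}1^{n₃}0^{n₃}) = i²/2 + ij + 3i/2 + j + 1`
(stated with both sides doubled, over ℕ). -/
theorem stmt3 (n1 n2 n3 i j k : ℕ) (h1 : 1 ≤ n1) (h2 : 1 ≤ n2) (h3 : 1 ≤ n3)
    (hperm : ({n1, n2, n3} : Multiset ℕ) = {i, j, k}) (hij : i ≤ j) (hjk : j ≤ k) :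
    2 * phiStar [n1, n2, n3] = i ^ 2 + 2 * i * j + 3 * i + 2 * j + 2 := by
  have hcases : (n1 = i ∧ n2 = j ∧ n3 = k) ∨ (n1 = i ∧ n2 = k ∧ n3 = j) ∨
      (n1 = j ∧ n2 = i ∧ n3 = k) ∨ (n1 = j ∧ n2 = k ∧ n3 = i) ∨
      (n1 = k ∧ n2 = i ∧ n3 = j) ∨ (n1 = k ∧ n2 = j ∧ n3 = i) := by
    have hp : [n1, n2, n3].Perm [i, j, k] := Multiset.coe_eq_coe.1 hperm
    rw [← List.mem_permutations'] at hp
    simp at hp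
    tauto
  rw [phiStar_three, mul_add, two_mul_sum_min]
  obtain ⟨u, rfl⟩ := Nat.exists_eq_add_of_le hij
  obtain ⟨v, rfl⟩ := Nat.exists_eq_add_of_le hjk
  have hsub : i - (i + u) = 0 ∧ i - (i + u + v) = 0 ∧ i + u - (i + u + v) = 0 := by omega
  have hmin : min i (i + u) = i ∧ min i (i + u + v) = i ∧ min (i + u) (i + u + v) = i + u ∧
      min (i + u) i = i ∧ min (i + u + v) i = i ∧ min (i + u + v) (i + u) = i + u := by omega
  rcases hcases with ⟨e1, e2, e3⟩ | ⟨e1, e2, e3⟩ | ⟨e1, e2, e3⟩ | ⟨e1, e2, e3⟩ |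
    ⟨e1, e2, e3⟩ | ⟨e1, e2, e3⟩ <;>
  · simp only [e1, e2, e3, hmin, hsub, Nat.add_sub_cancel_left]
    ring
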